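/- If q = 4 and n ≥ 2, then there exists a set of n instructions on A^n, each of which is an even permutation, that generates the alternating group Alt(A^n). -/

import Mathlib

open Equiv Equiv.Perm MulAction Function
open scoped Pointwise

section Primitivity

variable {α : Type*} [Fintype α] [DecidableEq α]

/-- A block which meets the support of a 3-cycle `t` of the group at `a`, and is not reduced to
`a`, contains `t a`. -/
theorem MulAction.IsBlock.apply_mem_of_isThreeCycle {G : Subgroup (Perm α)} {B : Set α}
    (hB : IsBlock G B) {t : Perm α} (ht : t ∈ G) (h3 : t.IsThreeCycle) {a b : α}
    (ha : a ∈ B) (hb : b ∈ B) (hab : b ≠ a) (hta : t a ≠ a) : t a ∈ B := by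
  have key : ∀ x ∈ B, t x ∈ B → t a ∈ B := fun x hx hxt ↦ by
    have h : (⟨t, ht⟩ : G) • B = B := hB.smul_eq_of_mem hx hxt
    rw [← h]
    exact Set.smul_mem_smul_set (a := (⟨t, ht⟩ : G)) ha
  by_cases htb : t b = b
  · exact key b hb (htb.symm ▸ hb)
  have hs : t.support = {a, t a, t (t a)} :=
    (h3.support_eq_iff_mem_support).2 (Perm.mem_support.2 hta)
  have hbs : b ∈ t.support := Perm.mem_support.2 htb
  rw [hs] at hbs
  simp only [Finset.mem_insert, Finset.mem_singleton] at hbs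
  rcases hbs with h | h | h
  · exact absurd h hab
  · exact h ▸ hb
  · refine key b hb ?_
    have h1 : (t ^ 3) a = a := by
      rw [← h3.orderOf, pow_orderOf_eq_one, one_apply]
    have h2 : t b = a := by rw [h]; exact h1
    rwa [h2]

/-- A transitive group generated by permutations which all act at some point `a` like
3-cycles of the group moving `a` is primitive. -/
theorem isPreprimitive_closure_of_isThreeCycle {S : Set (Perm α)} (a : α)
    [IsPretransitive (Subgroup.closure S) α]
    (h : ∀ g ∈ S, ∃ t ∈ Subgroup.closure S, t.IsThreeCycle ∧ t a ≠ a ∧ t a = g a) :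
    IsPreprimitive (Subgroup.closure S) α := by
  refine IsPreprimitive.of_isTrivialBlock_base a fun {B} ha hB ↦ ?_
  by_cases hsub : B.Subsingleton
  · exact Or.inl hsub
  obtain ⟨b, hb, hba⟩ := (Set.not_subsingleton_iff.1 hsub).exists_ne a
  have hle : Subgroup.closure S ≤ stabilizer (Perm α) B := by
    refine (Subgroup.closure_le _).2 fun g hg ↦ ?_
    obtain ⟨t, ht, h3, hta, htg⟩ := h g hg
    have hmem : g a ∈ B := htg ▸ hB.apply_mem_of_isThreeCycle ht h3 ha hb hba hta
    exact hB.smul_eq_of_mem (g := (⟨g, Subgroup.subset_closure hg⟩ : Subgroup.closure S)) ha hmem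
  refine Or.inr (Set.eq_univ_of_forall fun x ↦ ?_)
  obtain ⟨g, rfl⟩ := exists_smul_eq (Subgroup.closure S) a x
  have h1 : (g : Perm α) • B = B := hle g.2
  rw [← h1]
  exact Set.smul_mem_smul_set (a := (g : Perm α)) ha

end Primitivity

section Register

variable {ι A : Type*} [DecidableEq ι]

/-- The permutation of `ι → A` which applies to register `j` a permutation depending on the
contents of the other registers. -/
def registerPerm (j : ι) : (({i // i ≠ j} → A) → Perm A) →* Perm (ι → A) where
  toFun s := (Equiv.funSplitAt j A).symm.permCongr (Equiv.prodCongrLeft s)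
  map_one' := by
    ext x i
    by_cases h : i = j <;> simp [Equiv.permCongr_apply, Equiv.funSplitAt, h]
  map_mul' s s' := by
    ext x i
    by_cases h : i = j <;> simp [Equiv.permCongr_apply, Equiv.funSplitAt, h]

theorem registerPerm_apply (j : ι) (s : ({i // i ≠ j} → A) → Perm A) (x : ι → A) :
    registerPerm j s x = update x j (s (fun i ↦ x i) (x j)) := by
  ext i
  by_cases h : i = j
  · subst h
    simp [registerPerm, Equiv.permCongr_apply, Equiv.funSplitAt]
  · simp [registerPerm, Equiv.permCongr_apply, Equiv.funSplitAt, h]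

variable [DecidableEq A]

/-- The permutation applied on each line: `c` on the constant line `z`, `d` on the constant
line `t`, and `r` on every other line. -/
def lineAction {κ : Type*} [Fintype κ] (z t : A) (c d r : Perm A) (y : κ → A) : Perm A :=
  if y = fun _ ↦ z then c else if y = fun _ ↦ t then d else r

variable [Fintype ι]

section Transitivity

variable {z t : A} {c d r : Perm A} {G : Subgroup (Perm (ι → A))}

/-- If some other register holds a value other than `z` and `t`, register `i` can be given any
value. -/
theorem exists_apply_eq_update_of_ne
    (hG : ∀ j, registerPerm j (lineAction z t c d r) ∈ G)
    (hr : ∀ a b, ∃ k : ℕ, (r ^ k) a = b) {x : ι → A} {i j : ι} (hij : i ≠ j)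
    (hz : x j ≠ z) (ht : x j ≠ t) (b : A) : ∃ g ∈ G, g x = update x i b := by
  obtain ⟨k, hk⟩ := hr (x i) b
  refine ⟨_, pow_mem (hG i) k, ?_⟩
  have h1 : (fun l : {l // l ≠ i} ↦ x l) ≠ fun _ ↦ z := fun h ↦
    hz (congrFun h ⟨j, hij.symm⟩)
  have h2 : (fun l : {l // l ≠ i} ↦ x l) ≠ fun _ ↦ t := fun h ↦
    ht (congrFun h ⟨j, hij.symm⟩)
  rw [← map_pow, registerPerm_apply, Pi.pow_apply, lineAction, if_neg h1, if_neg h2, hk]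

/-- While register `j` holds a value other than `z` and `t`, all other registers can be set
arbitrarily. -/
theorem exists_apply_eq_of_apply_eq
    (hG : ∀ j, registerPerm j (lineAction z t c d r) ∈ G)
    (hr : ∀ a b, ∃ k : ℕ, (r ^ k) a = b) {x y : ι → A} {j : ι}
    (hz : x j ≠ z) (ht : x j ≠ t) (hxy : x j = y j) : ∃ g ∈ G, g x = y := by
  suffices h : ∀ F : Finset ι, ∃ g ∈ G, g x = F.piecewise y x by
    obtain ⟨g, hg, h⟩ := h Finset.univ
    exact ⟨g, hg, by simpa using h⟩
  intro F
  induction F using Finset.induction_on with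
  | empty => exact ⟨1, one_mem G, by simp⟩
  | insert i F hi ih =>
    obtain ⟨g, hg, h⟩ := ih
    rw [Finset.piecewise_insert]
    by_cases hij : i = j
    · refine ⟨g, hg, ?_⟩
      rw [h, eq_comm, update_eq_self_iff, hij, ← hxy]
      by_cases hjF : j ∈ F <;> simp [hjF, hxy]
    · have hj : F.piecewise y x j = x j := by
        by_cases hjF : j ∈ F <;> simp [hjF, hxy]
      obtain ⟨g', hg', h'⟩ := exists_apply_eq_update_of_ne hG hr (x := F.piecewise y x) hij
        (by rwa [hj]) (by rwa [hj]) (y i)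
      exact ⟨g' * g, mul_mem hg' hg, by rw [mul_apply, h, h']⟩

/-- Register `j` can be given a value other than `z` and `t`, unless the state is `t` at `j` and
`z` elsewhere. -/
theorem exists_apply_ne
    (hG : ∀ j, registerPerm j (lineAction z t c d r) ∈ G)
    (hr : ∀ a b, ∃ k : ℕ, (r ^ k) a = b) {o : A} (hoz : o ≠ z) (hot : o ≠ t)
    (hcz : c z ≠ z) (hct : c z ≠ t) (hd : ∀ a, a = z ∨ a = t → d a ≠ z ∧ d a ≠ t)
    {x : ι → A} {j : ι} (hxj : x j = z ∨ x j = t)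
    (hx : x j = t → (fun l : {l // l ≠ j} ↦ x l) ≠ fun _ ↦ z) :
    ∃ g ∈ G, g x j ≠ z ∧ g x j ≠ t := by
  by_cases h1 : (fun l : {l // l ≠ j} ↦ x l) = fun _ ↦ z
  · have hxz : x j = z := hxj.resolve_right fun h ↦ hx h h1
    refine ⟨_, hG j, ?_⟩
    rw [registerPerm_apply, update_self, lineAction, if_pos h1, hxz]
    exact ⟨hcz, hct⟩
  by_cases h2 : (fun l : {l // l ≠ j} ↦ x l) = fun _ ↦ t
  · refine ⟨_, hG j, ?_⟩
    rw [registerPerm_apply, update_self, lineAction, if_neg h1, if_pos h2]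
    exact hd _ hxj
  · obtain ⟨k, hk⟩ := hr (x j) o
    refine ⟨_, pow_mem (hG j) k, ?_⟩
    rw [← map_pow, registerPerm_apply, Pi.pow_apply, update_self, lineAction, if_neg h1,
      if_neg h2, hk]
    exact ⟨hoz, hot⟩

theorem isPretransitive_of_registerPerm_mem [Nontrivial ι]
    (hG : ∀ j, registerPerm j (lineAction z t c d r) ∈ G) (hzt : z ≠ t)
    (hr : ∀ a b, ∃ k : ℕ, (r ^ k) a = b) {o : A} (hoz : o ≠ z) (hot : o ≠ t)
    (hcz : c z ≠ z) (hct : c z ≠ t) (hd : ∀ a, a = z ∨ a = t → d a ≠ z ∧ d a ≠ t) :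
    IsPretransitive G (ι → A) := by
  have h1 : ∀ x : ι → A, ∃ g ∈ G, ∃ j, g x j ≠ z ∧ g x j ≠ t := by
    intro x
    by_cases hx : ∃ j, x j ≠ z ∧ x j ≠ t
    · exact ⟨1, one_mem G, hx⟩
    have hx' : ∀ j, x j = z ∨ x j = t := fun j ↦ by
      by_contra h
      exact hx ⟨j, not_or.1 h⟩
    obtain ⟨i, j, hij⟩ := exists_pair_ne ι
    by_cases hi : x i = t ∧ (fun l : {l // l ≠ i} ↦ x l) = fun _ ↦ z
    · obtain ⟨g, hg, h⟩ := exists_apply_ne hG hr hoz hot hcz hct hd (hx' j) fun _ h ↦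
        hzt ((congrFun h ⟨i, hij⟩).symm.trans hi.1)
      exact ⟨g, hg, j, h⟩
    · obtain ⟨g, hg, h⟩ := exists_apply_ne hG hr hoz hot hcz hct hd (hx' i) fun h h' ↦
        hi ⟨h, h'⟩
      exact ⟨g, hg, i, h⟩
  have h2 : ∀ x : ι → A, ∃ g ∈ G, g x = fun _ ↦ o := by
    intro x
    obtain ⟨g, hg, j, hz, ht⟩ := h1 x
    obtain ⟨i, hij⟩ := exists_ne j
    obtain ⟨g', hg', h'⟩ := exists_apply_eq_of_apply_eq hG hr hz ht
      (y := update (fun _ ↦ o) j (g x j)) (by simp)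
    obtain ⟨g'', hg'', h''⟩ := exists_apply_eq_of_apply_eq hG hr
      (x := update (fun _ ↦ o) j (g x j)) (y := fun _ ↦ o) (j := i)
      (by simpa [hij] using hoz) (by simpa [hij] using hot) (by simp [hij])
    exact ⟨g'' * (g' * g), mul_mem hg'' (mul_mem hg' hg), by
      rw [mul_apply, mul_apply, h', h'']⟩
  refine ⟨fun x y ↦ ?_⟩
  obtain ⟨g, hg, hx⟩ := h2 x
  obtain ⟨g', hg', hy⟩ := h2 y
  refine ⟨⟨g'⁻¹ * g, mul_mem (inv_mem hg') hg⟩, ?_⟩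
  change (g'⁻¹ * g) x = y
  rw [mul_apply, hx, ← hy, ← mul_apply, inv_mul_cancel, one_apply]

end Transitivity

variable [Fintype A]

theorem sign_registerPerm (j : ι) (s : ({i // i ≠ j} → A) → Perm A) :
    sign (registerPerm j s) = ∏ y, sign (s y) :=
  (sign_permCongr _ _).trans (sign_prodCongrLeft s)

/-- Acting by a 3-cycle on a single line gives a 3-cycle. -/
theorem isThreeCycle_registerPerm_mulSingle (j : ι) (z : A) {c : Perm A}
    (hc : c.IsThreeCycle) :
    (registerPerm j (Pi.mulSingle (fun _ ↦ z) c)).IsThreeCycle := by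
  rw [← card_support_eq_three_iff, ← hc.card_support,
    ← Finset.card_image_of_injective c.support (update_injective (fun _ ↦ z) j)]
  congr 1
  ext x
  simp only [Perm.mem_support, Finset.mem_image, registerPerm_apply]
  constructor
  · intro hx
    by_cases hy : (fun i : {i // i ≠ j} ↦ x i) = fun _ ↦ z
    · have hxe : update (fun _ ↦ z) j (x j) = x := by
        ext i
        by_cases h : i = j
        · subst h; simp
        · simpa [h] using (congrFun hy ⟨i, h⟩).symm
      refine ⟨x j, fun h ↦ hx ?_, hxe⟩
      rw [hy, Pi.mulSingle_eq_same, h, update_eq_self]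
    · exact absurd (by rw [Pi.mulSingle_eq_of_ne hy, one_apply, update_eq_self]) hx
  · rintro ⟨a, ha, rfl⟩ h
    have hy : (fun i : {i // i ≠ j} ↦ update (fun _ ↦ z) j a (i : ι)) = fun _ ↦ z := by
      ext i
      simp [i.2]
    have := congrFun h j
    rw [hy] at this
    simp at this
    exact ha this

theorem prod_sign_lineAction {κ : Type*} [Fintype κ] [DecidableEq κ] [Nonempty κ] {z t : A}
    {c d r : Perm A} (hA : Even (Fintype.card A)) (hzt : z ≠ t) (hc : sign c = 1)
    (hd : sign d = 1) : ∏ y : κ → A, sign (lineAction z t c d r y) = 1 := by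
  have hne : (fun _ : κ ↦ z) ≠ fun _ ↦ t := fun h ↦
    hzt (congrFun h (Classical.arbitrary κ))
  have h : ∀ y : κ → A, sign (lineAction z t c d r y) =
      sign r * ((if y = fun _ ↦ z then sign r else 1) *
        (if y = fun _ ↦ t then sign r else 1)) := by
    intro y
    have hr : sign r * sign r = 1 := Int.units_mul_self _
    unfold lineAction
    by_cases h1 : y = fun _ ↦ z
    · simp [h1, hne, hc, hr]
    · by_cases h2 : y = fun _ ↦ t
      · simp [h2, hne.symm, hd, hr]
      · simp [h1, h2]
  have hcard : Even (Fintype.card (κ → A)) := by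
    rw [Fintype.card_fun]
    exact hA.pow_of_ne_zero Fintype.card_ne_zero
  obtain ⟨m, hm⟩ := hcard
  simp_rw [h, Finset.prod_mul_distrib, Finset.prod_ite_eq' Finset.univ]
  simp [Finset.card_univ, hm, pow_add, Int.units_mul_self, ← mul_pow]

theorem lineAction_pow_four {κ : Type*} [Fintype κ] [DecidableEq κ] {z t : A} {c d r : Perm A}
    (hc : c.IsThreeCycle) (hd : d ^ 4 = 1) (hr : r ^ 4 = 1) :
    lineAction (κ := κ) z t c d r ^ 4 = Pi.mulSingle (fun _ ↦ z) c := by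
  have h4 : c ^ 4 = c := by
    rw [pow_succ, ← hc.orderOf, pow_orderOf_eq_one, one_mul]
  ext1 y
  rw [Pi.pow_apply, Pi.mulSingle_apply]
  unfold lineAction
  split_ifs <;> assumption

end Register

theorem exists_perms_of_card_eq_four {A : Type*} [Fintype A] [DecidableEq A]
    (hA : Fintype.card A = 4) :
    ∃ (z t o : A) (c d r : Perm A), z ≠ t ∧ o ≠ z ∧ o ≠ t ∧ c.IsThreeCycle ∧ c z ≠ z ∧ c z ≠ t ∧
      (∀ a, a = z ∨ a = t → d a ≠ z ∧ d a ≠ t) ∧ sign d = 1 ∧ d ^ 4 = 1 ∧ r ^ 4 = 1 ∧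
      ∀ a b, ∃ k : ℕ, (r ^ k) a = b := by
  let e := (Fintype.equivFinOfCardEq hA).symm
  let φ := e.permCongrHom
  have hφ : ∀ p a, φ p (e a) = e (p a) := fun p a ↦ by simp [φ, Equiv.permCongr_apply]
  refine ⟨e 0, e 3, e 1, φ (swap 0 1 * swap 1 2), φ (swap 0 1 * swap 2 3), φ (finRotate 4),
    ?_, ?_, ?_, ?_, ?_, ?_, ?_, ?_, ?_, ?_, ?_⟩
  · simp
  · simp
  · simp
  · have h : ∀ i j, φ (swap i j) = swap (e i) (e j) := fun i j ↦ by
      ext x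
      simp [φ, Equiv.permCongr_apply, swap_apply_def, apply_ite e, Equiv.symm_apply_eq]
    rw [map_mul, h, h, swap_comm (e 0)]
    exact isThreeCycle_swap_mul_swap_same (by simp) (by simp) (by simp)
  · rw [hφ, e.injective.ne_iff]; decide
  · rw [hφ, e.injective.ne_iff]; decide
  · rintro _ (rfl | rfl) <;> rw [hφ, e.injective.ne_iff, e.injective.ne_iff] <;> decide
  · exact (sign_permCongr _ _).trans (by decide)
  · rw [← map_pow, ← map_one φ]; congr 1; decide
  · rw [← map_pow, ← map_one φ]; congr 1; decide
  · intro a b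
    obtain ⟨a, rfl⟩ := e.surjective a
    obtain ⟨b, rfl⟩ := e.surjective b
    have h : ∀ a b : Fin 4, ∃ k : Fin 4, (finRotate 4 ^ (k : ℕ)) a = b := by decide
    obtain ⟨k, hk⟩ := h a b
    exact ⟨k, by rw [← map_pow, hφ, hk]⟩


/-- An *instruction* on `A^n` is a permutation of `Fin n → A` which changes
at most one coordinate (the updated register `j`). -/
def IsInstruction {n : ℕ} {A : Type*} (g : Equiv.Perm (Fin n → A)) : Prop :=
  ∃ j : Fin n, ∀ (x : Fin n → A) (i : Fin n), i ≠ j → g x i = x i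

/-- If `q = 4`, then `Alt(A^n)` is generated by `n` even instructions. -/
theorem alternating_generated_q_four
    (n : ℕ) (A : Type*) [Fintype A] [DecidableEq A]
    (hA : Fintype.card A = 4) (hn : 2 ≤ n) :
    ∃ X : Finset (Equiv.Perm (Fin n → A)),
      X.card = n ∧
      (∀ g ∈ X, IsInstruction g ∧ g ∈ alternatingGroup (Fin n → A)) ∧
      Subgroup.closure (X : Set (Equiv.Perm (Fin n → A))) =
        alternatingGroup (Fin n → A) := by
  obtain ⟨z, t, o, c, d, r, hzt, hoz, hot, hc, hcz, hct, hd, hds, hd4, hr4, hr⟩ :=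
    exists_perms_of_card_eq_four hA
  have : Nontrivial (Fin n) := Fin.nontrivial_iff_two_le.2 hn
  let f : Fin n → Perm (Fin n → A) := fun j ↦ registerPerm j (lineAction z t c d r)
  have hf : ∀ j, f j (fun _ ↦ z) = update (fun _ ↦ z) j (c z) := fun j ↦ by
    simp [f, registerPerm_apply, lineAction]
  have hinj : Injective f := fun i j hij ↦ by
    by_contra hne
    have h := congrFun (congrArg (fun g : Perm (Fin n → A) ↦ g fun _ ↦ z) hij) i
    simp only [hf, update_self, update_of_ne hne] at h
    exact hcz h
  have heven : ∀ j, f j ∈ alternatingGroup (Fin n → A) := fun j ↦ by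
    obtain ⟨i, hij⟩ := exists_ne j
    have : Nonempty {i // i ≠ j} := ⟨⟨i, hij⟩⟩
    rw [mem_alternatingGroup, sign_registerPerm]
    exact prod_sign_lineAction (by rw [hA]; decide) hzt hc.sign hds
  let X : Finset (Perm (Fin n → A)) := Finset.univ.image f
  have hX : ∀ j, f j ∈ Subgroup.closure (X : Set (Perm (Fin n → A))) := fun j ↦
    Subgroup.subset_closure (by simp [X])
  have h4 : ∀ j, f j ^ 4 = registerPerm j (Pi.mulSingle (fun _ ↦ z) c) := fun j ↦ by
    rw [← map_pow, lineAction_pow_four hc hd4 hr4]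
  have h3 : ∀ j, (f j ^ 4).IsThreeCycle := fun j ↦ by
    rw [h4]
    exact isThreeCycle_registerPerm_mulSingle j z hc
  have htrans : IsPretransitive (Subgroup.closure (X : Set (Perm (Fin n → A)))) (Fin n → A) :=
    isPretransitive_of_registerPerm_mem hX hzt hr hoz hot hcz hct hd
  have hprim : IsPreprimitive (Subgroup.closure (X : Set (Perm (Fin n → A)))) (Fin n → A) := by
    refine isPreprimitive_closure_of_isThreeCycle (fun _ ↦ z) fun g hg ↦ ?_
    obtain ⟨j, rfl⟩ : ∃ j, f j = g := by simpa [X] using hg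
    have heq : (f j ^ 4) (fun _ ↦ z) = f j fun _ ↦ z := by
      rw [h4, hf, registerPerm_apply, Pi.mulSingle_eq_same]
    refine ⟨f j ^ 4, pow_mem (hX j) 4, h3 j, ?_, heq⟩
    rw [heq, hf, Ne, update_eq_self_iff]
    exact hcz
  refine ⟨X, ?_, ?_, le_antisymm ?_ ?_⟩
  · rw [Finset.card_image_of_injective _ hinj, Finset.card_univ, Fintype.card_fin]
  · intro g hg
    obtain ⟨j, rfl⟩ : ∃ j, f j = g := by simpa [X] using hg
    refine ⟨⟨j, fun x i hij ↦ ?_⟩, heven j⟩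
    simp only [f, registerPerm_apply, update_of_ne hij]
  · refine (Subgroup.closure_le _).2 fun g hg ↦ ?_
    obtain ⟨j, rfl⟩ : ∃ j, f j = g := by simpa [X] using hg
    exact heven j
  · have j : Fin n := ⟨0, by omega⟩
    exact alternatingGroup_le_of_isPreprimitive_of_isThreeCycle_mem hprim (h3 j)
      (pow_mem (hX j) 4)
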